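/- Under the stated hypotheses, the following recursion holds in A: Θ_1 = v²K^{−1}[B_0, B_1]_{v^{−2}}; Θ_2 = −v^{−1}C + v²K^{−1}([B_0, B_2]_{v^{−2}} + [B_1, B_1]_{v^{−2}}); and Θ_n = v^{−2}CΘ_{n−2} + v²K^{−1}([B_0, B_n]_{v^{−2}} + [B_{n−1}, B_1]_{v^{−2}}) for all n ≥ 3. In particular, every Θ_n with n ≥ 1 lies in the ℚ(v)[C^{±1}, K^{±1}]-span of 1 and the elements [B_k, B_{l+1}]_{v^{−2}} + [B_l, B_{k+1}]_{v^{−2}} (k, l ∈ ℤ). -/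

import Mathlib

noncomputable section

abbrev F : Type := RatFunc ℚ

def v : F := RatFunc.X

/-- The `v`-commutator `[x,y]_{v^a} = xy − v^a yx` in an `F`-algebra. -/
def qc {A : Type} [Ring A] [Algebra F A] (x y : A) (a : ℤ) : A := x * y - (v ^ a) • (y * x)

theorem v_ne : v ≠ 0 := RatFunc.X_ne_zero

theorem vv_ne : v ^ 2 - 1 ≠ 0 := by
  intro h
  have h1 : (algebraMap (Polynomial ℚ) (RatFunc ℚ)) (Polynomial.X ^ 2 - Polynomial.C 1) = 0 := by
    rw [map_sub, map_pow, RatFunc.algebraMap_X]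
    simpa [v] using h
  rw [map_eq_zero_iff _ (IsFractionRing.injective (Polynomial ℚ) (RatFunc ℚ))] at h1
  exact Polynomial.X_pow_sub_C_ne_zero (by norm_num) _ h1

theorem coef : (v ^ (-2 : ℤ) - 1) * (v - v⁻¹)⁻¹ = -v⁻¹ := by
  have h := v_ne
  have h2 := vv_ne
  have h3 : v - v⁻¹ ≠ 0 := by
    intro h4
    apply h2
    have : v * (v - v⁻¹) = 0 := by rw [h4, mul_zero]
    rw [mul_sub, mul_inv_cancel₀ h] at this
    rw [pow_two]; exact this
  rw [← div_eq_mul_inv, div_eq_iff h3, zpow_neg]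
  have e : v⁻¹ * v = 1 := inv_mul_cancel₀ h
  have e2 : (v ^ (2 : ℤ))⁻¹ = v⁻¹ * v⁻¹ := by
    rw [show (2 : ℤ) = ((2 : ℕ) : ℤ) from rfl, zpow_natCast, pow_two, mul_inv]
  rw [e2]
  linear_combination e

theorem v2m2 : v ^ 2 * v ^ (-2 : ℤ) = 1 := by
  rw [zpow_neg]; exact mul_inv_cancel₀ (pow_ne_zero 2 v_ne)

theorem v2m4 : v ^ 2 * v ^ (-4 : ℤ) = v ^ (-2 : ℤ) := by
  rw [show (v ^ 2 : F) = v ^ (2 : ℤ) from rfl, ← zpow_add₀ v_ne]; norm_num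

theorem qc_flip {A : Type} [Ring A] [Algebra F A] (x y : A) :
    - ((v ^ (-2 : ℤ)) • qc x y 2) = qc y x (-2) := by
  have : v ^ (-2 : ℤ) * v ^ (2 : ℤ) = 1 := by
    rw [← zpow_add₀ v_ne]; norm_num
  unfold qc
  rw [smul_sub, smul_smul, this, one_smul]
  abel

/-- the recursion for the `Θ_n` and the resulting span statement. -/
theorem stmt16 (A : Type) [Ring A] [Algebra F A] (C K : Aˣ)
    (hC : ∀ x : A, (C : A) * x = x * C) (hK : ∀ x : A, (K : A) * x = x * K)
    (B : ℤ → A) (Θ : ℤ → A)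
    (h0 : Θ 0 = ((v - v⁻¹)⁻¹ : F) • (1 : A)) (hneg : ∀ n : ℤ, n < 0 → Θ n = 0)
    (hrel : ∀ k l : ℤ,
      qc (B k) (B (l + 1)) (-2) - (v ^ (-2 : ℤ)) • qc (B (k + 1)) (B l) 2
      = (v ^ (-2 : ℤ)) • (Θ (l - k + 1) * ((C ^ k * K : Aˣ) : A))
        - (v ^ (-4 : ℤ)) • (Θ (l - k - 1) * ((C ^ (k + 1) * K : Aˣ) : A))
        + (v ^ (-2 : ℤ)) • (Θ (k - l + 1) * ((C ^ l * K : Aˣ) : A))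
        - (v ^ (-4 : ℤ)) • (Θ (k - l - 1) * ((C ^ (l + 1) * K : Aˣ) : A))) :
    Θ 1 = (v ^ 2) • (((K⁻¹ : Aˣ) : A) * qc (B 0) (B 1) (-2)) ∧
    Θ 2 = (-(v⁻¹)) • ((C : A))
          + (v ^ 2) • (((K⁻¹ : Aˣ) : A) * (qc (B 0) (B 2) (-2) + qc (B 1) (B 1) (-2))) ∧
    (∀ n : ℤ, 3 ≤ n →
      Θ n = (v ^ (-2 : ℤ)) • ((C : A) * Θ (n - 2))
        + (v ^ 2) • (((K⁻¹ : Aˣ) : A) * (qc (B 0) (B n) (-2) + qc (B (n - 1)) (B 1) (-2)))) ∧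
    (∀ n : ℤ, 1 ≤ n →
      Θ n ∈ Submodule.span F
        (Set.range (fun ab : ℤ × ℤ => ((C ^ ab.1 * K ^ ab.2 : Aˣ) : A)) ∪
         Set.range (fun q : ℤ × ℤ × ℤ × ℤ =>
           ((C ^ q.1 * K ^ q.2.1 : Aˣ) : A) *
             (qc (B q.2.2.1) (B (q.2.2.2 + 1)) (-2) + qc (B q.2.2.2) (B (q.2.2.1 + 1)) (-2))))) := by
  have hKi : ∀ x : A, ((K⁻¹ : Aˣ) : A) * (x * K) = x := by
    intro x; rw [← hK, Units.inv_mul_cancel_left]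
  -- the relation at k = 0, l = n - 1
  have key : ∀ n : ℤ, (v ^ 2) • (((K⁻¹ : Aˣ) : A) *
        (qc (B 0) (B n) (-2) + qc (B (n - 1)) (B 1) (-2)))
      = Θ n - (v ^ (-2 : ℤ)) • (Θ (n - 2) * C)
        + Θ (2 - n) * ((C ^ (n - 1) : Aˣ) : A)
        - (v ^ (-2 : ℤ)) • (Θ (-n) * ((C ^ n : Aˣ) : A)) := by
    intro n
    have h := hrel 0 (n - 1)
    rw [sub_eq_add_neg (qc _ _ _), qc_flip] at h
    rw [show n - 1 + 1 = n by ring, show n - 1 - 0 + 1 = n by ring,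
      show n - 1 - 0 - 1 = n - 2 by ring, show 0 - (n - 1) + 1 = 2 - n by ring,
      show 0 - (n - 1) - 1 = -n by ring, zero_add, zpow_zero, zpow_one, one_mul] at h
    rw [h]
    simp only [Units.val_mul, ← mul_assoc]
    rw [mul_sub, mul_add, mul_sub]
    simp only [mul_smul_comm, hKi]
    simp only [smul_sub, smul_add, smul_smul, v2m2, v2m4, one_smul]
  have r1 : Θ 1 = (v ^ 2) • (((K⁻¹ : Aˣ) : A) * qc (B 0) (B 1) (-2)) := by
    have h := key 1
    rw [show (1 : ℤ) - 2 = -1 by norm_num, hneg (-1) (by norm_num),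
      show (1 : ℤ) - 1 = 0 by norm_num, show (2 : ℤ) - 1 = 1 by norm_num, zpow_zero,
      Units.val_one, mul_one, zero_mul, zero_mul, smul_zero, sub_zero, sub_zero,
      mul_add, smul_add, ← two_smul F, ← two_smul F (Θ 1)] at h
    exact (smul_right_injective A (two_ne_zero : (2 : F) ≠ 0) h).symm
  have r2 : Θ 2 = (-(v⁻¹)) • ((C : A))
          + (v ^ 2) • (((K⁻¹ : Aˣ) : A) * (qc (B 0) (B 2) (-2) + qc (B 1) (B 1) (-2))) := by
    have h := key 2
    rw [show (2 : ℤ) - 2 = 0 by norm_num, hneg (-2) (by norm_num),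
      show (2 : ℤ) - 1 = 1 by norm_num, zpow_one, zero_mul, smul_zero, sub_zero, h0,
      smul_mul_assoc, one_mul, smul_smul] at h
    rw [h, ← coef, sub_mul, sub_smul, one_mul]
    abel
  have r3 : ∀ n : ℤ, 3 ≤ n →
      Θ n = (v ^ (-2 : ℤ)) • ((C : A) * Θ (n - 2))
        + (v ^ 2) • (((K⁻¹ : Aˣ) : A) *
          (qc (B 0) (B n) (-2) + qc (B (n - 1)) (B 1) (-2))) := by
    intro n hn
    rw [key n, hneg (2 - n) (by omega), hneg (-n) (by omega), zero_mul, zero_mul, smul_zero, hC]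
    abel
  refine ⟨r1, r2, r3, ?_⟩
  set S := Submodule.span F
        (Set.range (fun ab : ℤ × ℤ => ((C ^ ab.1 * K ^ ab.2 : Aˣ) : A)) ∪
         Set.range (fun q : ℤ × ℤ × ℤ × ℤ =>
           ((C ^ q.1 * K ^ q.2.1 : Aˣ) : A) *
             (qc (B q.2.2.1) (B (q.2.2.2 + 1)) (-2)
               + qc (B q.2.2.2) (B (q.2.2.1 + 1)) (-2)))) with hS
  have hgen : ∀ n : ℤ, ((K⁻¹ : Aˣ) : A) *
      (qc (B 0) (B n) (-2) + qc (B (n - 1)) (B 1) (-2)) ∈ S := by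
    intro n
    refine Submodule.subset_span (Or.inr ⟨(0, -1, 0, n - 1), ?_⟩)
    simp
  have hCS : ∀ x ∈ S, (C : A) * x ∈ S := by
    intro x hx
    induction hx using Submodule.span_induction with
    | mem x hx =>
      rcases hx with ⟨⟨a, b⟩, rfl⟩ | ⟨⟨a, b, k, l⟩, rfl⟩
      · refine Submodule.subset_span (Or.inl ⟨(a + 1, b), ?_⟩)
        simp only [← Units.val_mul]
        rw [← mul_assoc, add_comm, zpow_add, zpow_one]
      · refine Submodule.subset_span (Or.inr ⟨(a + 1, b, k, l), ?_⟩)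
        simp only [← mul_assoc (C : A), ← Units.val_mul]
        rw [← mul_assoc, add_comm a 1, zpow_add, zpow_one]
    | zero => rw [mul_zero]; exact S.zero_mem
    | add x y _ _ hx hy => rw [mul_add]; exact S.add_mem hx hy
    | smul a x _ hx => rw [mul_smul_comm]; exact S.smul_mem a hx
  have main : ∀ m : ℕ, Θ ((m : ℤ) + 1) ∈ S := by
    intro m
    induction m using Nat.strong_induction_on with
    | _ m ih =>
      match m, ih with
      | 0, _ =>
        have h := S.smul_mem (2 : F)⁻¹ (hgen 1)
        rw [show (1 : ℤ) - 1 = 0 by norm_num, mul_add, ← two_smul F, smul_smul,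
          inv_mul_cancel₀ (two_ne_zero : (2 : F) ≠ 0), one_smul] at h
        rw [show ((0 : ℕ) : ℤ) + 1 = 1 by norm_num, r1]
        exact S.smul_mem _ h
      | 1, _ =>
        rw [show ((1 : ℕ) : ℤ) + 1 = 2 by norm_num, r2]
        refine S.add_mem (S.smul_mem _ ?_) (S.smul_mem _ ?_)
        · exact Submodule.subset_span (Or.inl ⟨(1, 0), by simp⟩)
        · have h := hgen 2
          rwa [show (2 : ℤ) - 1 = 1 by norm_num] at h
      | m + 2, ih =>
        rw [r3 _ (by push_cast; omega)]
        refine S.add_mem (S.smul_mem _ (hCS _ ?_)) (S.smul_mem _ (hgen _))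
        have h := ih m (by omega)
        rwa [show ((m + 2 : ℕ) : ℤ) + 1 - 2 = (m : ℤ) + 1 by push_cast; ring]
  intro n hn
  have h := main (n - 1).toNat
  rwa [show (((n - 1).toNat : ℕ) : ℤ) + 1 = n by omega] at h
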